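/- Let b(ζ) = ζ · Π_{γ∈Γ, γ≠1} [(γ(0) − ζ)/(1 − conjugate(γ(0))ζ)] · [|γ(0)|/γ(0)] be the Green's function (Blaschke product) of a Fuchsian group Γ with respect to the origin, assuming the Blaschke condition Σ_{γ∈Γ}(1 − |γ(0)|) < ∞. Then b is character-automorphic: there exists a character μ ∈ Γ* such that b(γ(ζ)) = μ(γ)b(ζ) for all γ ∈ Γ and ζ ∈ 𝔻, and |b(ζ)| < 1 for ζ ∈ 𝔻. -/

import Mathlib

open scoped ComplexConjugate

/-- The Möbius transformation associated to a 2×2 complex matrix. -/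
noncomputable def moebius (γ : Matrix (Fin 2) (Fin 2) ℂ) (ζ : ℂ) : ℂ :=
  (γ 0 0 * ζ + γ 0 1) / (γ 1 0 * ζ + γ 1 1)

/-- Membership in SU(1,1). -/
def memSU11 (γ : Matrix (Fin 2) (Fin 2) ℂ) : Prop :=
  γ 1 1 = conj (γ 0 0) ∧ γ 1 0 = conj (γ 0 1) ∧ γ 0 0 * γ 1 1 - γ 0 1 * γ 1 0 = 1

/-- The Blaschke product (Green's function) of a Fuchsian group at the origin:
`b(ζ) = ζ ∏_{γ ≠ 1} [(γ(0) − ζ)/(1 − conj(γ(0)) ζ)]·[|γ(0)|/γ(0)]`. -/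
noncomputable def blaschkeB {Γ : Type*} [Group Γ]
    (M : Γ → Matrix (Fin 2) (Fin 2) ℂ) (ζ : ℂ) : ℂ :=
  ζ * ∏' g : {g : Γ // g ≠ 1},
    ((moebius (M g) 0 - ζ) / (1 - conj (moebius (M g) 0) * ζ)
      * ((‖moebius (M g) 0‖ : ℂ) / moebius (M g) 0))

theorem one_sub_conj_mul_ne_zero {w ζ : ℂ} (hw : ‖w‖ < 1) (hζ : ‖ζ‖ < 1) :
    1 - conj w * ζ ≠ 0 := by
  intro h
  have h1 : conj w * ζ = 1 := (sub_eq_zero.mp h).symm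
  have h2 : ‖w‖ * ‖ζ‖ = 1 := by simpa using congrArg norm h1
  nlinarith [norm_nonneg w, norm_nonneg ζ]

theorem one_sub_conj_mul_self (z w : ℂ) :
    ‖1 - conj w * z‖ ^ 2 - ‖w - z‖ ^ 2 = (1 - ‖w‖ ^ 2) * (1 - ‖z‖ ^ 2) := by
  simp only [← Complex.normSq_eq_norm_sq, Complex.normSq_apply, Complex.sub_re, Complex.sub_im,
    Complex.mul_re, Complex.mul_im, Complex.conj_re, Complex.conj_im, Complex.one_re,
    Complex.one_im]
  ring

theorem norm_blaschke_div_le_one {w ζ : ℂ} (hw : ‖w‖ < 1) (hζ : ‖ζ‖ < 1) :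
    ‖(w - ζ) / (1 - conj w * ζ)‖ ≤ 1 := by
  rw [norm_div]
  refine div_le_one_of_le₀ ?_ (norm_nonneg _)
  have h := one_sub_conj_mul_self ζ w
  have h1 : 0 ≤ (1 - ‖w‖ ^ 2) * (1 - ‖ζ‖ ^ 2) :=
    mul_nonneg (by nlinarith [norm_nonneg w]) (by nlinarith [norm_nonneg ζ])
  exact le_of_sq_le_sq (by linarith) (norm_nonneg _)

namespace memSU11

variable {A : Matrix (Fin 2) (Fin 2) ℂ}

theorem norm_sq_sub (hA : memSU11 A) : ‖A 0 0‖ ^ 2 - ‖A 0 1‖ ^ 2 = 1 := by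
  obtain ⟨h1, h2, h3⟩ := hA
  rw [h1, h2, Complex.mul_conj, Complex.mul_conj, Complex.normSq_eq_norm_sq,
    Complex.normSq_eq_norm_sq] at h3
  exact_mod_cast h3

theorem denom_ne_zero (hA : memSU11 A) {ζ : ℂ} (hζ : ‖ζ‖ < 1) : A 1 0 * ζ + A 1 1 ≠ 0 := by
  intro h
  have h1 : ‖A 0 1‖ * ‖ζ‖ = ‖A 0 0‖ := by
    have := congrArg norm (eq_neg_of_add_eq_zero_left h)
    simpa [hA.1, hA.2.1] using this
  have h2 := hA.norm_sq_sub
  have h3 : ‖ζ‖ ^ 2 ≤ 1 := by nlinarith [norm_nonneg ζ]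
  have h4 : ‖A 0 0‖ ^ 2 = ‖A 0 1‖ ^ 2 * ‖ζ‖ ^ 2 := by rw [← h1]; ring
  nlinarith [mul_le_mul_of_nonneg_left h3 (sq_nonneg ‖A 0 1‖)]

theorem conj_moebius (hA : memSU11 A) (ζ : ℂ) :
    conj (moebius A ζ) = (A 1 1 * conj ζ + A 1 0) / (A 0 1 * conj ζ + A 0 0) := by
  simp [moebius, hA.1, hA.2.1]

theorem blaschke_div_moebius (hA : memSU11 A) {w ζ : ℂ} (hw : ‖w‖ < 1) (hζ : ‖ζ‖ < 1) :
    (moebius A w - moebius A ζ) / (1 - conj (moebius A w) * moebius A ζ) =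
      conj (A 1 0 * w + A 1 1) / (A 1 0 * w + A 1 1) * ((w - ζ) / (1 - conj w * ζ)) := by
  have hw0 := hA.denom_ne_zero hw
  have hζ0 := hA.denom_ne_zero hζ
  have hc : conj (A 1 0 * w + A 1 1) = A 0 1 * conj w + A 0 0 := by simp [hA.1, hA.2.1]
  have hc0 : A 0 1 * conj w + A 0 0 ≠ 0 := by rw [← hc]; exact (map_ne_zero _).mpr hw0
  have hd := one_sub_conj_mul_ne_zero hw hζ
  have hdet := hA.2.2
  have hnum : moebius A w - moebius A ζ =
      (w - ζ) / ((A 1 0 * w + A 1 1) * (A 1 0 * ζ + A 1 1)) := by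
    rw [moebius, moebius, div_sub_div _ _ hw0 hζ0]
    congr 1
    linear_combination (w - ζ) * hdet
  have hden : 1 - conj (moebius A w) * moebius A ζ =
      (1 - conj w * ζ) / ((A 0 1 * conj w + A 0 0) * (A 1 0 * ζ + A 1 1)) := by
    rw [hA.conj_moebius, moebius, div_mul_div_comm, eq_div_iff (mul_ne_zero hc0 hζ0), sub_mul,
      div_mul_cancel₀ _ (mul_ne_zero hc0 hζ0)]
    linear_combination (1 - conj w * ζ) * hdet
  rw [hnum, hden, hc]
  generalize A 1 0 * ζ + A 1 1 = D at *
  generalize 1 - conj w * ζ = E at *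
  field_simp

theorem norm_moebius_lt_one (hA : memSU11 A) {ζ : ℂ} (hζ : ‖ζ‖ < 1) : ‖moebius A ζ‖ < 1 := by
  have h0 := hA.denom_ne_zero hζ
  rw [moebius, norm_div, div_lt_one (norm_pos_iff.mpr h0)]
  have h : ‖A 1 0 * ζ + A 1 1‖ ^ 2 - ‖A 0 0 * ζ + A 0 1‖ ^ 2 =
      (‖A 0 0‖ ^ 2 - ‖A 0 1‖ ^ 2) * (1 - ‖ζ‖ ^ 2) := by
    rw [hA.1, hA.2.1]
    simp only [← Complex.normSq_eq_norm_sq, Complex.normSq_apply, Complex.add_re, Complex.add_im,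
      Complex.mul_re, Complex.mul_im, Complex.conj_re, Complex.conj_im]
    ring
  rw [hA.norm_sq_sub] at h
  exact lt_of_pow_lt_pow_left₀ 2 (norm_nonneg _) (by nlinarith [norm_nonneg ζ])

end memSU11

/-- The unimodular constant normalizing the Blaschke factor with zero `a`; it is chosen to be `-1`
at the origin, so that the normalized factor there is the identity. -/
noncomputable def blaschkePhase (a : ℂ) : ℂ :=
  if a = 0 then -1 else (‖a‖ : ℂ) / a

theorem norm_blaschkePhase (a : ℂ) : ‖blaschkePhase a‖ = 1 := by
  unfold blaschkePhase
  split_ifs with h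
  · simp
  · simp [h]

/-- The normalized Blaschke factor with zero `a`. -/
noncomputable def blaschkeFactor (a ζ : ℂ) : ℂ :=
  (a - ζ) / (1 - conj a * ζ) * blaschkePhase a

theorem blaschkeFactor_zero (ζ : ℂ) : blaschkeFactor 0 ζ = ζ := by
  simp [blaschkeFactor, blaschkePhase]

theorem norm_blaschkeFactor_le_one {a ζ : ℂ} (ha : ‖a‖ < 1) (hζ : ‖ζ‖ < 1) :
    ‖blaschkeFactor a ζ‖ ≤ 1 := by
  rw [blaschkeFactor, norm_mul, norm_blaschkePhase, mul_one]
  exact norm_blaschke_div_le_one ha hζ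

theorem blaschkeFactor_ne_zero {a ζ : ℂ} (ha : ‖a‖ < 1) (hζ : ‖ζ‖ < 1) (h : a ≠ ζ) :
    blaschkeFactor a ζ ≠ 0 := by
  refine mul_ne_zero (div_ne_zero (sub_ne_zero.mpr h) (one_sub_conj_mul_ne_zero ha hζ)) ?_
  rw [← norm_ne_zero_iff, norm_blaschkePhase]
  exact one_ne_zero

theorem norm_blaschkeFactor_sub_one_le {a ζ : ℂ} (ha : ‖a‖ < 1) (hζ : ‖ζ‖ < 1) :
    ‖blaschkeFactor a ζ - 1‖ ≤ (1 - ‖a‖) * ((1 + ‖ζ‖) / (1 - ‖ζ‖)) := by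
  have hpos : 0 < 1 - ‖ζ‖ := by linarith
  have hden : 1 - ‖ζ‖ ≤ ‖1 - conj a * ζ‖ := by
    have h1 : ‖(1 : ℂ)‖ - ‖conj a * ζ‖ ≤ ‖1 - conj a * ζ‖ := norm_sub_norm_le _ _
    rw [norm_one, norm_mul, RCLike.norm_conj] at h1
    nlinarith [norm_nonneg ζ]
  by_cases h0 : a = 0
  · subst h0
    rw [blaschkeFactor_zero, norm_zero, sub_zero, one_mul, le_div_iff₀ hpos]
    have h1 : ‖ζ - 1‖ ≤ ‖ζ‖ + ‖(1 : ℂ)‖ := norm_sub_le _ _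
    rw [norm_one] at h1
    nlinarith [norm_nonneg ζ, norm_nonneg (ζ - 1)]
  · have hd := one_sub_conj_mul_ne_zero ha hζ
    have hsq : conj a * a = (‖a‖ : ℂ) ^ 2 := Complex.conj_mul' a
    have key : blaschkeFactor a ζ - 1 =
        -((1 - (‖a‖ : ℂ)) * (1 + blaschkePhase a * ζ) / (1 - conj a * ζ)) := by
      rw [blaschkeFactor, blaschkePhase, if_neg h0, div_mul_eq_mul_div, div_sub_one hd, ← neg_div]
      congr 1
      field_simp
      linear_combination ζ * hsq
    rw [key, norm_neg, norm_div, norm_mul, mul_div_assoc]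
    have hn : ‖1 - (‖a‖ : ℂ)‖ = 1 - ‖a‖ := by
      rw [← Complex.ofReal_one, ← Complex.ofReal_sub, Complex.norm_real, Real.norm_eq_abs,
        abs_of_pos (by linarith)]
    rw [hn]
    refine mul_le_mul_of_nonneg_left ?_ (by linarith)
    refine div_le_div₀ (by positivity) ?_ hpos hden
    calc ‖1 + blaschkePhase a * ζ‖ ≤ ‖(1 : ℂ)‖ + ‖blaschkePhase a * ζ‖ := norm_add_le _ _
      _ = 1 + ‖ζ‖ := by rw [norm_one, norm_mul, norm_blaschkePhase, one_mul]

theorem memSU11.exists_blaschkeFactor_moebius {A : Matrix (Fin 2) (Fin 2) ℂ} (hA : memSU11 A)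
    {w : ℂ} (hw : ‖w‖ < 1) :
    ∃ u : ℂ, ‖u‖ = 1 ∧ ∀ ζ : ℂ, ‖ζ‖ < 1 →
      blaschkeFactor (moebius A w) (moebius A ζ) = u * blaschkeFactor w ζ := by
  have hp : blaschkePhase w ≠ 0 := by
    rw [← norm_ne_zero_iff, norm_blaschkePhase]
    exact one_ne_zero
  have hn := norm_ne_zero_iff.mpr (hA.denom_ne_zero hw)
  refine ⟨conj (A 1 0 * w + A 1 1) / (A 1 0 * w + A 1 1) *
    (blaschkePhase (moebius A w) / blaschkePhase w), ?_, fun ζ hζ => ?_⟩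
  · rw [norm_mul, norm_div, norm_div, RCLike.norm_conj, norm_blaschkePhase, norm_blaschkePhase,
      div_self hn, div_one, one_mul]
  · rw [blaschkeFactor, blaschkeFactor, hA.blaschke_div_moebius hw hζ]
    field_simp

/-- Absolutely convergent products converge. -/
theorem multipliable_of_summable_norm_sub_one {ι : Type*} {f : ι → ℂ}
    (hf : Summable fun i => ‖f i - 1‖) : Multipliable f := by
  simpa using multipliable_one_add_of_summable hf

theorem norm_tprod_le_one {ι : Type*} {f : ι → ℂ} (hf : Multipliable f) (h : ∀ i, ‖f i‖ ≤ 1) :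
    ‖∏' i, f i‖ ≤ 1 := by
  refine le_of_tendsto hf.hasProd.norm (Filter.Eventually.of_forall fun s => ?_)
  exact Finset.prod_le_one (fun i _ => norm_nonneg _) (fun i _ => h i)

theorem norm_tprod_eq_one {ι : Type*} {f : ι → ℂ} (hf : Multipliable f) (h : ∀ i, ‖f i‖ = 1) :
    ‖∏' i, f i‖ = 1 := by
  rw [hf.norm_tprod]
  simp [h]

section Group

variable {Γ : Type*} {M : Γ → Matrix (Fin 2) (Fin 2) ℂ}

theorem summable_norm_blaschkeFactor_sub_one (hSU : ∀ g, memSU11 (M g))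
    (hblaschke : Summable (fun g : Γ => 1 - ‖moebius (M g) 0‖)) {ζ : ℂ} (hζ : ‖ζ‖ < 1) :
    Summable fun g : Γ => ‖blaschkeFactor (moebius (M g) 0) ζ - 1‖ :=
  .of_nonneg_of_le (fun _ => norm_nonneg _)
    (fun g => norm_blaschkeFactor_sub_one_le ((hSU g).norm_moebius_lt_one (by simp)) hζ)
    (hblaschke.mul_right _)

variable [Group Γ]

theorem blaschkeB_eq_mul_tprod (hfree : ∀ g : Γ, g ≠ 1 → moebius (M g) 0 ≠ 0) (ζ : ℂ) :
    blaschkeB M ζ = ζ * ∏' g : {g : Γ // g ≠ 1}, blaschkeFactor (moebius (M g) 0) ζ := by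
  rw [blaschkeB]
  congr 1
  refine tprod_congr fun g => ?_
  rw [blaschkeFactor, blaschkePhase, if_neg (hfree g g.2)]

theorem blaschkeB_eq_tprod (hSU : ∀ g, memSU11 (M g)) (hone : moebius (M 1) 0 = 0)
    (hfree : ∀ g : Γ, g ≠ 1 → moebius (M g) 0 ≠ 0)
    (hblaschke : Summable (fun g : Γ => 1 - ‖moebius (M g) 0‖)) {ζ : ℂ} (hζ : ‖ζ‖ < 1) :
    blaschkeB M ζ = ∏' g : Γ, blaschkeFactor (moebius (M g) 0) ζ := by
  have hs := summable_norm_blaschkeFactor_sub_one hSU hblaschke hζ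
  have h1 : HasProd ((fun g : Γ => blaschkeFactor (moebius (M g) 0) ζ) ∘
      ((↑) : ({1} : Set Γ) → Γ)) ζ := by
    have := hasProd_unique
      ((fun g : Γ => blaschkeFactor (moebius (M g) 0) ζ) ∘ ((↑) : ({1} : Set Γ) → Γ))
    simpa [hone, blaschkeFactor_zero] using this
  have h2 := (multipliable_of_summable_norm_sub_one (hs.subtype ({1}ᶜ : Set Γ))).hasProd
  rw [blaschkeB_eq_mul_tprod hfree]
  exact (h1.mul_compl h2).tprod_eq.symm

theorem norm_blaschkeB_lt_one (hSU : ∀ g, memSU11 (M g))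
    (hfree : ∀ g : Γ, g ≠ 1 → moebius (M g) 0 ≠ 0)
    (hblaschke : Summable (fun g : Γ => 1 - ‖moebius (M g) 0‖)) {ζ : ℂ} (hζ : ‖ζ‖ < 1) :
    ‖blaschkeB M ζ‖ < 1 := by
  have hs := summable_norm_blaschkeFactor_sub_one hSU hblaschke hζ
  have hm : Multipliable fun g : {g : Γ // g ≠ 1} => blaschkeFactor (moebius (M g) 0) ζ :=
    multipliable_of_summable_norm_sub_one (hs.subtype ({1}ᶜ : Set Γ))
  have hle := norm_tprod_le_one hm fun g =>
    norm_blaschkeFactor_le_one ((hSU g).norm_moebius_lt_one (by simp)) hζ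
  rw [blaschkeB_eq_mul_tprod hfree, norm_mul]
  exact (mul_le_of_le_one_right (norm_nonneg _) hle).trans_lt hζ

end Group

/-- Under the Blaschke condition `Σ_γ (1 − |γ(0)|) < ∞`, the Green's
function `b` of a Fuchsian group `Γ` at the origin is character-automorphic: there is a
character `μ ∈ Γ*` with `b(γ(ζ)) = μ(γ) b(ζ)` on `𝔻`, and `|b(ζ)| < 1` on `𝔻`. -/
theorem stmt12
    {Γ : Type*} [Group Γ] [Countable Γ]
    (M : Γ → Matrix (Fin 2) (Fin 2) ℂ)
    (hSU : ∀ g, memSU11 (M g))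
    (hone : ∀ ζ ∈ Metric.ball (0 : ℂ) 1, moebius (M 1) ζ = ζ)
    (hmul : ∀ g h : Γ, ∀ ζ ∈ Metric.ball (0 : ℂ) 1,
      moebius (M (g * h)) ζ = moebius (M g) (moebius (M h) ζ))
    (hfree : ∀ g : Γ, g ≠ 1 → moebius (M g) 0 ≠ 0)
    (hblaschke : Summable (fun g : Γ => 1 - ‖moebius (M g) 0‖)) :
    ∃ μ : Γ →* Circle,
      (∀ g : Γ, ∀ ζ ∈ Metric.ball (0 : ℂ) 1,
        blaschkeB M (moebius (M g) ζ) = (μ g : ℂ) * blaschkeB M ζ) ∧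
      (∀ ζ ∈ Metric.ball (0 : ℂ) 1, ‖blaschkeB M ζ‖ < 1) := by
  have hball : ∀ {ζ : ℂ}, ζ ∈ Metric.ball (0 : ℂ) 1 ↔ ‖ζ‖ < 1 := mem_ball_zero_iff
  have h0 : (0 : ℂ) ∈ Metric.ball (0 : ℂ) 1 := by simp
  set a : Γ → ℂ := fun g => moebius (M g) 0 with ha
  have ha1 : ∀ g, ‖a g‖ < 1 := fun g => (hSU g).norm_moebius_lt_one (hball.mp h0)
  have hb : ∀ {ζ : ℂ}, ‖ζ‖ < 1 → blaschkeB M ζ = ∏' g, blaschkeFactor (a g) ζ :=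
    fun hζ => blaschkeB_eq_tprod hSU (hone 0 h0) hfree hblaschke hζ
  have hs : ∀ {ζ : ℂ}, ‖ζ‖ < 1 → Summable fun g => ‖blaschkeFactor (a g) ζ - 1‖ :=
    fun hζ => summable_norm_blaschkeFactor_sub_one hSU hblaschke hζ
  have hm : ∀ {ζ : ℂ}, ‖ζ‖ < 1 → Multipliable fun g => blaschkeFactor (a g) ζ :=
    fun hζ => multipliable_of_summable_norm_sub_one (hs hζ)
  have hu : ∀ h g : Γ, ∃ u : ℂ, ‖u‖ = 1 ∧ ∀ ζ : ℂ, ‖ζ‖ < 1 →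
      blaschkeFactor (a g) (moebius (M h) ζ) = u * blaschkeFactor (a (h⁻¹ * g)) ζ := by
    intro h g
    have hag : a g = moebius (M h) (a (h⁻¹ * g)) := by
      rw [ha, ← hmul h (h⁻¹ * g) 0 h0, mul_inv_cancel_left]
    rw [hag]
    exact (hSU h).exists_blaschkeFactor_moebius (ha1 _)
  choose u hu1 hu using hu
  have hmu : ∀ h, Multipliable fun g => u h g := by
    intro h
    refine multipliable_of_summable_norm_sub_one ?_
    have hz : ‖(0 : ℂ)‖ < 1 := hball.mp h0
    refine .of_nonneg_of_le (fun _ => norm_nonneg _) (fun g => ?_)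
      (((Equiv.mulLeft h⁻¹).summable_iff.mpr (hs hz)).add
        (hs ((hSU h).norm_moebius_lt_one hz)))
    have hsplit : u h g - 1 = -(u h g * (blaschkeFactor (a (h⁻¹ * g)) 0 - 1)) +
        (blaschkeFactor (a g) (moebius (M h) 0) - 1) := by
      rw [hu h g 0 hz]
      ring
    rw [hsplit]
    refine (norm_add_le _ _).trans_eq ?_
    rw [norm_neg, norm_mul, hu1, one_mul]
    rfl
  have hcocycle : ∀ h k g, u (h * k) g = u h g * u k (h⁻¹ * g) := by
    intro h k g
    obtain ⟨ζ, hζ, hne⟩ : ∃ ζ : ℂ, ‖ζ‖ < 1 ∧ a ((h * k)⁻¹ * g) ≠ ζ := by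
      by_cases hz : a ((h * k)⁻¹ * g) = 0
      · exact ⟨1 / 2, by norm_num, by rw [hz]; norm_num⟩
      · exact ⟨0, hball.mp h0, hz⟩
    refine mul_right_cancel₀ (blaschkeFactor_ne_zero (ha1 _) hζ hne) ?_
    rw [← hu (h * k) g ζ hζ, hmul h k ζ (hball.mpr hζ),
      hu h g _ ((hSU k).norm_moebius_lt_one hζ), hu k _ ζ hζ, mul_inv_rev, mul_assoc k⁻¹, mul_assoc]
  let c : Γ → Circle := fun h =>
    ⟨∏' g, u h g, mem_sphere_zero_iff_norm.mpr
      (norm_tprod_eq_one (hmu h) (hu1 h))⟩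
  have hc : ∀ h, (c h : ℂ) = ∏' g, u h g := fun _ => rfl
  have hcmul : ∀ h k, c (h * k) = c h * c k := by
    intro h k
    apply Circle.ext
    rw [Circle.coe_mul, hc, hc, hc, ← (Equiv.mulLeft h⁻¹).tprod_eq (u k)]
    exact (tprod_congr (hcocycle h k)).trans
      ((hmu h).tprod_mul ((Equiv.mulLeft h⁻¹).multipliable_iff.mpr (hmu k)))
  refine ⟨MonoidHom.mk' c hcmul, fun h ζ hζ => ?_, fun ζ hζ => ?_⟩
  · rw [hball] at hζ
    rw [hb hζ, hb ((hSU h).norm_moebius_lt_one hζ), MonoidHom.mk'_apply, hc,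
      ← (Equiv.mulLeft h⁻¹).tprod_eq fun g => blaschkeFactor (a g) ζ]
    have hshift : Multipliable fun g => blaschkeFactor (a (Equiv.mulLeft h⁻¹ g)) ζ :=
      ((Equiv.mulLeft h⁻¹).multipliable_iff (f := fun g => blaschkeFactor (a g) ζ)).mpr (hm hζ)
    rw [← (hmu h).tprod_mul hshift]
    exact tprod_congr fun g => hu h g ζ hζ
  · exact norm_blaschkeB_lt_one hSU hfree hblaschke (hball.mp hζ)
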